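/- arXiv:1812.11796 — 5 statements merged into one kernel-verified Lean document; each statement's English description precedes it below -/
import Mathlib

section
/- For the single-sequence SDP with parameter n ≥ 3: val(P) = 0 and val(D) = 1, so there is a positive duality gap of exactly 1. -/
open Matrix

/-- The optimal value of the primal SDP (P). -/
noncomputable def valP {n m : ℕ} (A : Fin m → Matrix (Fin n) (Fin n) ℝ)
    (B : Matrix (Fin n) (Fin n) ℝ) (c : Fin m → ℝ) : EReal :=
  sSup ((fun x : Fin m → ℝ => ((∑ i, c i * x i : ℝ) : EReal)) ''
    {x | (B - ∑ i, x i • A i).PosSemidef})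

/-- The optimal value of the dual SDP (D). -/
noncomputable def valD {n m : ℕ} (A : Fin m → Matrix (Fin n) (Fin n) ℝ)
    (B : Matrix (Fin n) (Fin n) ℝ) (c : Fin m → ℝ) : EReal :=
  sInf ((fun Y : Matrix (Fin n) (Fin n) ℝ => (((B * Y).trace : ℝ) : EReal)) ''
    {Y | Y.PosSemidef ∧ ∀ i, ((A i) * Y).trace = c i})

/-- `Eij n i j` : the `n×n` symmetric matrix whose only nonzero entries are `1`
in positions `(i,j)` and `(j,i)` (0-based indices). -/
def Eij (n i j : ℕ) : Matrix (Fin n) (Fin n) ℝ :=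
  Matrix.of fun a b => if (a.val = i ∧ b.val = j) ∨ (a.val = j ∧ b.val = i) then 1 else 0

/-- The constraint matrices of the single-sequence SDP (0-based index `k`):
`A₁ = E₁` and `Aᵢ = Eᵢ + E_{i-1,n}` for `i = 2, …, n-1` (1-based indices of the paper). -/
def singleA (n : ℕ) : Fin (n - 1) → Matrix (Fin n) (Fin n) ℝ := fun k =>
  if k.val = 0 then Eij n 0 0 else Eij n k.val k.val + Eij n (k.val - 1) (n - 1)

/-- The right hand side of the single-sequence SDP: ones in the first `n-1`
diagonal entries, zeros elsewhere. -/
def singleB (n : ℕ) : Matrix (Fin n) (Fin n) ℝ :=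
  Matrix.of fun a b => if a = b ∧ a.val < n - 1 then 1 else 0

/-- The objective vector of the single-sequence SDP: `c = e_{n-1} ∈ ℝ^{n-1}`. -/
def singleC (n : ℕ) : Fin (n - 1) → ℝ := fun k => if k.val = n - 2 then 1 else 0

theorem Matrix.PosSemidef.apply_eq_zero_of_diag_eq_zero {ι : Type*} [Fintype ι]
    {M : Matrix ι ι ℝ} (hM : M.PosSemidef) {i : ι} (hi : M i i = 0) (j : ι) : M i j = 0 := by
  have hdet := (hM.submatrix ![i, j]).det_nonneg
  have hsymm : M j i = M i j := by simpa using hM.isHermitian.apply i j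
  simp only [det_fin_two, submatrix_apply, cons_val_zero, cons_val_one, hi, hsymm] at hdet
  nlinarith [mul_self_nonneg (M i j)]

theorem Eij_self (n : ℕ) (i : Fin n) : Eij n i i = single i i 1 := by
  ext a b
  simp only [Eij, of_apply, single_apply, Fin.ext_iff]
  grind

theorem Eij_of_ne {n : ℕ} {i j : Fin n} (hij : i ≠ j) :
    Eij n i j = single i j 1 + single j i 1 := by
  ext a b
  simp only [Eij, of_apply, single_apply, Matrix.add_apply]
  grind

theorem trace_Eij_self_mul {n : ℕ} (i : Fin n) (Y : Matrix (Fin n) (Fin n) ℝ) :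
    (Eij n i i * Y).trace = Y i i := by
  simp [Eij_self, trace_single_mul]

theorem trace_Eij_mul_of_ne {n : ℕ} {i j : Fin n} (hij : i ≠ j) (Y : Matrix (Fin n) (Fin n) ℝ) :
    (Eij n i j * Y).trace = Y j i + Y i j := by
  simp [Eij_of_ne hij, add_mul, trace_single_mul]

theorem trace_singleA_zero_mul {n : ℕ} (h : 0 < n - 1) (Y : Matrix (Fin n) (Fin n) ℝ) :
    (singleA n ⟨0, h⟩ * Y).trace = Y ⟨0, by lia⟩ ⟨0, by lia⟩ := by
  simpa [singleA] using trace_Eij_self_mul ⟨0, by lia⟩ Y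

theorem trace_singleA_succ_mul {n k : ℕ} (h : k + 1 < n - 1) (Y : Matrix (Fin n) (Fin n) ℝ) :
    (singleA n ⟨k + 1, h⟩ * Y).trace =
      Y ⟨k + 1, by lia⟩ ⟨k + 1, by lia⟩ +
        (Y ⟨n - 1, by lia⟩ ⟨k, by lia⟩ + Y ⟨k, by lia⟩ ⟨n - 1, by lia⟩) := by
  have hdiag := trace_Eij_self_mul ⟨k + 1, by lia⟩ Y
  have hoff := trace_Eij_mul_of_ne (i := ⟨k, by lia⟩) (j := ⟨n - 1, by lia⟩)
    (by simp only [ne_eq, Fin.mk.injEq]; lia) Y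
  simp only [singleA, Nat.add_eq_zero_iff, one_ne_zero, and_false, if_false, Nat.add_sub_cancel,
    add_mul, trace_add]
  exact congrArg₂ (· + ·) hdiag hoff

theorem sum_singleC_mul {n : ℕ} (hn : 2 ≤ n) (x : Fin (n - 1) → ℝ) :
    ∑ i, singleC n i * x i = x ⟨n - 2, by lia⟩ := by
  rw [Finset.sum_eq_single ⟨n - 2, by lia⟩]
  · simp [singleC]
  · intro k _ hk
    have : k.val ≠ n - 2 := fun h => hk (Fin.ext h)
    simp [singleC, this]
  · simp

theorem singleB_eq_diagonal (n : ℕ) :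
    singleB n = diagonal fun a => if a.val < n - 1 then 1 else 0 := by
  ext a b
  simp only [singleB, of_apply, diagonal_apply]
  grind

theorem singleB_posSemidef (n : ℕ) : (singleB n).PosSemidef := by
  rw [singleB_eq_diagonal, posSemidef_diagonal_iff]
  intro i
  split_ifs <;> norm_num

theorem trace_singleB_mul (n : ℕ) (Y : Matrix (Fin n) (Fin n) ℝ) :
    (singleB n * Y).trace = ∑ a, if a.val < n - 1 then Y a a else 0 := by
  simp [singleB_eq_diagonal, trace, diagonal_mul]

theorem eq_zero_of_posSemidef_singleB_sub {n : ℕ} (hn : 3 ≤ n) {x : Fin (n - 1) → ℝ}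
    (hx : (singleB n - ∑ i, x i • singleA n i).PosSemidef) : x ⟨n - 2, by lia⟩ = 0 := by
  have hdiag : (singleB n - ∑ i, x i • singleA n i) ⟨n - 1, by lia⟩ ⟨n - 1, by lia⟩ = 0 := by
    have hB : singleB n ⟨n - 1, by lia⟩ ⟨n - 1, by lia⟩ = 0 := by simp [singleB]
    rw [Matrix.sub_apply, hB, Matrix.sum_apply, Finset.sum_eq_zero, sub_zero]
    intro k _
    have := k.isLt
    rw [Matrix.smul_apply, smul_eq_mul, mul_eq_zero]
    right
    simp only [singleA, Eij]
    split_ifs <;> simp <;> grind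
  have hoff := hx.apply_eq_zero_of_diag_eq_zero hdiag ⟨n - 3, by lia⟩
  have hB : singleB n ⟨n - 1, by lia⟩ ⟨n - 3, by lia⟩ = 0 := by simp [singleB]
  rw [Matrix.sub_apply, hB, Matrix.sum_apply,
    Finset.sum_eq_single ⟨n - 2, by lia⟩] at hoff
  · have hA : singleA n ⟨n - 2, by lia⟩ ⟨n - 1, by lia⟩ ⟨n - 3, by lia⟩ = 1 := by
      simp only [singleA, Eij]
      split_ifs <;> simp <;> grind
    simpa [hA] using hoff
  · intro k _ hk
    have hlt := k.isLt
    have hne : k.val ≠ n - 2 := fun h => hk (Fin.ext h)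
    rw [Matrix.smul_apply, smul_eq_mul, mul_eq_zero]
    right
    simp only [singleA, Eij]
    split_ifs <;> simp <;> grind
  · simp

theorem valP_single {n : ℕ} (hn : 3 ≤ n) : valP (singleA n) (singleB n) (singleC n) = 0 := by
  apply le_antisymm
  · apply sSup_le
    rintro _ ⟨x, hx, rfl⟩
    simp only [sum_singleC_mul (by lia : 2 ≤ n), eq_zero_of_posSemidef_singleB_sub hn hx]
    simp
  · apply le_sSup
    exact ⟨0, by simpa using singleB_posSemidef n, by simp⟩

theorem diag_eq_of_dual_feasible {n : ℕ} (hn : 3 ≤ n) {Y : Matrix (Fin n) (Fin n) ℝ}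
    (hY : Y.PosSemidef) (hA : ∀ i, (singleA n i * Y).trace = singleC n i) (k : ℕ)
    (hk : k < n - 1) :
    Y ⟨k, by lia⟩ ⟨k, by lia⟩ = if k = n - 2 then 1 else 0 := by
  induction k with
  | zero => simpa [singleC] using (trace_singleA_zero_mul hk Y).symm.trans (hA ⟨0, hk⟩)
  | succ k ih =>
    have hprev := ih (by lia)
    rw [if_neg (by lia)] at hprev
    have hrow := hY.apply_eq_zero_of_diag_eq_zero hprev ⟨n - 1, by lia⟩
    have hsymm : Y ⟨n - 1, by lia⟩ ⟨k, by lia⟩ = Y ⟨k, by lia⟩ ⟨n - 1, by lia⟩ := by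
      simpa using hY.isHermitian.apply ⟨k, by lia⟩ ⟨n - 1, by lia⟩
    have h := (trace_singleA_succ_mul hk Y).symm.trans (hA ⟨k + 1, hk⟩)
    simpa [hsymm, hrow, singleC] using h

theorem trace_singleB_mul_of_dual_feasible {n : ℕ} (hn : 3 ≤ n) {Y : Matrix (Fin n) (Fin n) ℝ}
    (hY : Y.PosSemidef) (hA : ∀ i, (singleA n i * Y).trace = singleC n i) :
    (singleB n * Y).trace = 1 := by
  have hdiag := diag_eq_of_dual_feasible hn hY hA
  rw [trace_singleB_mul, Finset.sum_eq_single ⟨n - 2, by lia⟩]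
  · rw [if_pos (by simp only; lia), hdiag _ (by lia), if_pos rfl]
  · intro a _ ha
    have hne : a.val ≠ n - 2 := fun h => ha (Fin.ext h)
    split_ifs with hlt
    · simpa [hne] using hdiag a hlt
    · rfl
  · simp

theorem dual_feasible_diagonal (n : ℕ) :
    (diagonal fun a : Fin n => if a.val = n - 2 then (1 : ℝ) else 0).PosSemidef ∧
      ∀ i, (singleA n i * diagonal fun a : Fin n => if a.val = n - 2 then (1 : ℝ) else 0).trace =
        singleC n i := by
  constructor
  · rw [posSemidef_diagonal_iff]
    intro i
    split_ifs <;> norm_num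
  · rintro ⟨_ | k, hk⟩
    · rw [trace_singleA_zero_mul]
      simp [singleC]
    · rw [trace_singleA_succ_mul]
      have hne : k ≠ n - 1 := by lia
      simp [singleC, hne, hne.symm]

theorem valD_single {n : ℕ} (hn : 3 ≤ n) : valD (singleA n) (singleB n) (singleC n) = 1 := by
  apply le_antisymm
  · obtain ⟨hY, hA⟩ := dual_feasible_diagonal n
    exact sInf_le ⟨_, ⟨hY, hA⟩, by simp [trace_singleB_mul_of_dual_feasible hn hY hA]⟩
  · apply le_sInf
    rintro _ ⟨Y, ⟨hY, hA⟩, rfl⟩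
    simp [trace_singleB_mul_of_dual_feasible hn hY hA]

/-- For the single-sequence SDP with parameter `n ≥ 3`, `val(P) = 0` and
`val(D) = 1`: there is a positive duality gap of exactly `1`. -/
theorem singleSeq_gap {n : ℕ} (hn : 3 ≤ n) :
    valP (singleA n) (singleB n) (singleC n) = 0 ∧
    valD (singleA n) (singleB n) (singleC n) = 1 :=
  ⟨valP_single hn, valD_single hn⟩
end

section
/- Suppose the primal SDP (P) is feasible, val(P) < +∞, and the dual (D) is infeasible. Then (D) is weakly infeasible: the affine subspace H = {Y ∈ Sym(n) : trace(AᵢY) = cᵢ for i = 1,…,m} does not intersect the cone of positive semidefinite matrices, yet has distance zero to it, i.e., for every ε > 0 there exist Y ∈ H and a positive semidefinite S with ‖Y − S‖_F < ε (Frobenius norm). -/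
open Matrix

/-- The Frobenius norm of a real matrix. -/
noncomputable def frobNorm {n : ℕ} (M : Matrix (Fin n) (Fin n) ℝ) : ℝ :=
  Real.sqrt (∑ a, ∑ b, (M a b) ^ 2)

/-- The linear map `Y ↦ (trace (Aᵢ Y))ᵢ`. -/
def traceMap {n m : ℕ} (A : Fin m → Matrix (Fin n) (Fin n) ℝ) :
    Matrix (Fin n) (Fin n) ℝ →ₗ[ℝ] (Fin m → ℝ) :=
  LinearMap.pi fun i => Matrix.traceLinearMap (Fin n) ℝ ℝ ∘ₗ LinearMap.mulLeft ℝ (A i)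

@[simp]
theorem traceMap_apply {n m : ℕ} (A : Fin m → Matrix (Fin n) (Fin n) ℝ)
    (Y : Matrix (Fin n) (Fin n) ℝ) (i : Fin m) : traceMap A Y i = (A i * Y).trace := rfl

theorem traceMap_transpose {n m : ℕ} {A : Fin m → Matrix (Fin n) (Fin n) ℝ}
    (hsymm : ∀ i, (A i).IsSymm) (Y : Matrix (Fin n) (Fin n) ℝ) :
    traceMap A Yᵀ = traceMap A Y := by
  ext i
  rw [traceMap_apply, traceMap_apply, ← Matrix.trace_transpose (A i * Y),
    Matrix.transpose_mul, (hsymm i).eq, Matrix.trace_mul_comm]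

theorem continuous_frobNorm {n : ℕ} : Continuous (frobNorm (n := n)) := by
  unfold frobNorm
  fun_prop

theorem convex_setOf_posSemidef {n : ℕ} :
    Convex ℝ {S : Matrix (Fin n) (Fin n) ℝ | S.PosSemidef} :=
  fun _ hS _ hT _ _ ha hb _ => (hS.smul ha).add (hT.smul hb)

/-- A linear map between real vector spaces has a linear section over its range, extended to
the whole codomain. -/
theorem LinearMap.exists_generalized_inverse {K V W : Type*} [Field K] [AddCommGroup V]
    [Module K V] [AddCommGroup W] [Module K W] (f : V →ₗ[K] W) :
    ∃ g : W →ₗ[K] V, ∀ v, f (g (f v)) = f v := by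
  obtain ⟨r, hr⟩ := f.rangeRestrict.exists_rightInverse_of_surjective f.range_rangeRestrict
  obtain ⟨g, hg⟩ := r.exists_extend
  refine ⟨g, fun v => ?_⟩
  have h1 : g (f v) = r (f.rangeRestrict v) := LinearMap.congr_fun hg (f.rangeRestrict v)
  have h2 := congrArg Subtype.val (LinearMap.congr_fun hr (f.rangeRestrict v))
  rw [h1]
  exact h2

/-- A bounded feasible primal has no improving recession direction. -/
theorem sum_mul_nonpos_of_valP_lt_top {n m : ℕ} {A : Fin m → Matrix (Fin n) (Fin n) ℝ}
    {B : Matrix (Fin n) (Fin n) ℝ} {c : Fin m → ℝ}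
    (hfeas : ∃ x : Fin m → ℝ, (B - ∑ i, x i • A i).PosSemidef) (hval : valP A B c < ⊤)
    {d : Fin m → ℝ} (hd : (-∑ i, d i • A i).PosSemidef) : ∑ i, c i * d i ≤ 0 := by
  obtain ⟨x, hx⟩ := hfeas
  obtain ⟨r, hr, -⟩ := EReal.lt_iff_exists_real_btwn.1 hval
  by_contra! hpos
  have bound : ∀ t : ℝ, 0 ≤ t → ∑ i, c i * x i + t * ∑ i, c i * d i < r := by
    intro t ht
    have hmem : (B - ∑ i, (x + t • d) i • A i).PosSemidef := by
      convert hx.add (hd.smul ht) using 1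
      simp only [Pi.add_apply, Pi.smul_apply, smul_eq_mul, add_smul, mul_smul,
        Finset.sum_add_distrib, smul_neg, Finset.smul_sum]
      abel
    have hle := (le_sSup (Set.mem_image_of_mem
      (fun x : Fin m → ℝ => ((∑ i, c i * x i : ℝ) : EReal)) hmem)).trans_lt hr
    have hlt := EReal.coe_lt_coe_iff.1 hle
    simpa [mul_add, Finset.sum_add_distrib, Finset.mul_sum, mul_left_comm] using hlt
  have h := bound (|r - ∑ i, c i * x i| / ∑ i, c i * d i) (by positivity)
  rw [div_mul_cancel₀ _ hpos.ne'] at h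
  linarith [le_abs_self (r - ∑ i, c i * x i)]

/-- If `d` pairs nonpositively with `traceMap A S` for all psd `S`, then `-∑ dᵢ Aᵢ` is psd. -/
theorem posSemidef_neg_sum_smul {n m : ℕ} {A : Fin m → Matrix (Fin n) (Fin n) ℝ}
    (hsymm : ∀ i, (A i).IsSymm) {d : Fin m → ℝ}
    (hd : ∀ S : Matrix (Fin n) (Fin n) ℝ, S.PosSemidef → ∑ i, traceMap A S i * d i ≤ 0) :
    (-∑ i, d i • A i).PosSemidef := by
  rw [Matrix.posSemidef_iff_dotProduct_mulVec]
  refine ⟨?_, fun v => ?_⟩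
  · simp only [Matrix.IsHermitian, Matrix.conjTranspose_eq_transpose_of_trivial,
      Matrix.transpose_neg, Matrix.transpose_sum, Matrix.transpose_smul, (hsymm _).eq]
  · have h := hd _ (Matrix.posSemidef_vecMulVec_self_star v)
    simp only [traceMap_apply, Matrix.mul_vecMulVec, Matrix.trace_vecMulVec, star_trivial] at h
    simpa [Matrix.neg_mulVec, Matrix.sum_mulVec, Matrix.smul_mulVec, dotProduct_sum,
      dotProduct_comm v, mul_comm, sum_dotProduct] using h

/-- The right-hand side of a dual whose primal is feasible and bounded is a limit of
right-hand sides for which the dual is feasible. -/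
theorem mem_closure_traceMap_image {n m : ℕ} {A : Fin m → Matrix (Fin n) (Fin n) ℝ}
    {B : Matrix (Fin n) (Fin n) ℝ} {c : Fin m → ℝ} (hsymm : ∀ i, (A i).IsSymm)
    (hfeas : ∃ x : Fin m → ℝ, (B - ∑ i, x i • A i).PosSemidef) (hval : valP A B c < ⊤) :
    c ∈ closure (traceMap A '' {S | S.PosSemidef}) := by
  by_contra hc
  obtain ⟨f, u, hfu, huc⟩ := geometric_hahn_banach_closed_point
    (convex_setOf_posSemidef.linear_image (traceMap A)).closure isClosed_closure hc
  have hf : ∀ y : Fin m → ℝ, f y = ∑ i, y i * f (Pi.single i 1) := fun y => by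
    conv_lhs => rw [pi_eq_sum_univ' y]
    simp [map_sum]
  have hlt : ∀ S : Matrix (Fin n) (Fin n) ℝ, S.PosSemidef → f (traceMap A S) < u :=
    fun S hS => hfu _ (subset_closure ⟨S, hS, rfl⟩)
  have hu : 0 < u := by simpa using hlt 0 Matrix.PosSemidef.zero
  have hnonpos : ∀ S : Matrix (Fin n) (Fin n) ℝ, S.PosSemidef → f (traceMap A S) ≤ 0 := by
    intro S hS
    by_contra! hpos
    have h := hlt _ (hS.smul (div_pos hu hpos).le)
    rw [map_smul, map_smul, smul_eq_mul, div_mul_cancel₀ _ hpos.ne'] at h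
    exact lt_irrefl _ h
  have h := sum_mul_nonpos_of_valP_lt_top hfeas hval
    (posSemidef_neg_sum_smul hsymm fun S hS => (hf _).symm.trans_le (hnonpos S hS))
  rw [← hf] at h
  linarith

/-- If the primal SDP (P) is feasible with `val(P) < +∞` and the dual (D) is
infeasible, then (D) is weakly infeasible: the affine subspace
`H = {Y ∈ Sym(n) : trace(Aᵢ Y) = cᵢ ∀i}` does not intersect the psd cone, yet has
distance zero to it. -/
theorem dual_weakly_infeasible {n m : ℕ}
    (A : Fin m → Matrix (Fin n) (Fin n) ℝ) (B : Matrix (Fin n) (Fin n) ℝ)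
    (c : Fin m → ℝ)
    (hsymm : ∀ i, (A i).IsSymm) (hBsymm : B.IsSymm)
    (hfeas : ∃ x : Fin m → ℝ, (B - ∑ i, x i • A i).PosSemidef)
    (hval : valP A B c < ⊤)
    (hinf : ¬ ∃ Y : Matrix (Fin n) (Fin n) ℝ, Y.PosSemidef ∧
      ∀ i, ((A i) * Y).trace = c i) :
    (¬ ∃ Y : Matrix (Fin n) (Fin n) ℝ, Y.IsSymm ∧ (∀ i, ((A i) * Y).trace = c i) ∧
      Y.PosSemidef) ∧
    (∀ ε : ℝ, 0 < ε → ∃ Y S : Matrix (Fin n) (Fin n) ℝ, Y.IsSymm ∧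
      (∀ i, ((A i) * Y).trace = c i) ∧ S.PosSemidef ∧ frobNorm (Y - S) < ε) := by
  refine ⟨fun ⟨Y, _, hY, hpsd⟩ => hinf ⟨Y, hpsd, hY⟩, fun ε hε => ?_⟩
  have hc := mem_closure_traceMap_image hsymm hfeas hval
  obtain ⟨g, hg⟩ := (traceMap A).exists_generalized_inverse
  have hrange : c ∈ LinearMap.range (traceMap A) := by
    have hclosed : IsClosed (LinearMap.range (traceMap A) : Set (Fin m → ℝ)) :=
      Submodule.closed_of_finiteDimensional _
    refine hclosed.closure_subset_iff.2 ?_ hc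
    rintro _ ⟨S, -, rfl⟩
    exact LinearMap.mem_range_self _ S
  obtain ⟨Z, rfl⟩ := hrange
  have hgcont : Continuous g := g.continuous_of_finiteDimensional
  let D : (Fin m → ℝ) → Matrix (Fin n) (Fin n) ℝ := fun y =>
    (1 / 2 : ℝ) • (g (traceMap A Z - y) + (g (traceMap A Z - y))ᵀ)
  have hD : Continuous fun y => frobNorm (D y) := continuous_frobNorm.comp (by fun_prop)
  have hD0 : frobNorm (D (traceMap A Z)) < ε := by simpa [D, frobNorm] using hε
  obtain ⟨_, hlt, S, hS, rfl⟩ :=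
    mem_closure_iff.1 hc _ (isOpen_lt hD continuous_const) hD0
  refine ⟨S + D (traceMap A S), S, ?_, fun i => ?_, hS, by simpa using hlt⟩
  · refine Matrix.IsSymm.add hS.isHermitian ?_
    simp [D, Matrix.IsSymm, add_comm]
  · rw [← traceMap_apply]
    refine congrFun ?_ i
    rw [map_add, map_smul, map_add, traceMap_transpose hsymm, ← map_sub, hg, ← two_smul ℝ,
      smul_smul, map_sub]
    norm_num
end

section
/- (Key claim establishing that the singularity degree of the homogeneous dual of the double-sequence SDP equals m.) For the double-sequence SDP with parameter m ≥ 2 (n = 2m+1), let 1 ≤ i ≤ m and let (Y₁,…,Y_i) be a strict facial reduction sequence for the psd cone such that every Yⱼ lies in the linear span of {B, A₂,…,A_m}. Then the set of positive semidefinite W with trace(YⱼW) = 0 for all j = 1,…,i is exactly 0_{m+i} ⊕ PSD^{m−i+1}, the set of positive semidefinite matrices whose first m+i rows and columns are zero. -/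
open Matrix

/-- The constraint matrices of the double-sequence SDP with parameter `m`
(`n = 2m+1`, 0-based index `k`): `A₁ = E₁ + E_{m+1}`,
`Aᵢ = Eᵢ + E_{m+i} + E_{i-1,n} + E_{m+i-1,n}` for `i = 2, …, m-1`, and
`A_m = E_m - E_{2m} + E_{m-1,n} + E_{2m-1,n}` (1-based indices of the paper). -/
def doubleA (m : ℕ) : Fin m → Matrix (Fin (2 * m + 1)) (Fin (2 * m + 1)) ℝ := fun k =>
  if k.val = 0 then Eij (2 * m + 1) 0 0 + Eij (2 * m + 1) m m
  else if k.val = m - 1 then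
    Eij (2 * m + 1) (m - 1) (m - 1) - Eij (2 * m + 1) (2 * m - 1) (2 * m - 1) +
      Eij (2 * m + 1) (m - 2) (2 * m) + Eij (2 * m + 1) (2 * m - 2) (2 * m)
  else
    Eij (2 * m + 1) k.val k.val + Eij (2 * m + 1) (m + k.val) (m + k.val) +
      Eij (2 * m + 1) (k.val - 1) (2 * m) + Eij (2 * m + 1) (m + k.val - 1) (2 * m)

/-- The right hand side of the double-sequence SDP: ones in the first `m+1`
diagonal entries, zeros elsewhere. -/
def doubleB (m : ℕ) : Matrix (Fin (2 * m + 1)) (Fin (2 * m + 1)) ℝ :=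
  Matrix.of fun a b => if a = b ∧ a.val < m + 1 then 1 else 0

/-- `(Y₁, …, Y_k)` is a strict facial reduction sequence for the `n×n` psd cone. -/
def IsStrictFRSeq {n k : ℕ} (Y : Fin k → Matrix (Fin n) (Fin n) ℝ) : Prop :=
  ∀ j : Fin k,
    (∀ W : Matrix (Fin n) (Fin n) ℝ, W.PosSemidef →
      (∀ l : Fin k, l < j → ((Y l) * W).trace = 0) → 0 ≤ ((Y j) * W).trace) ∧
    (∃ W : Matrix (Fin n) (Fin n) ℝ, W.PosSemidef ∧
      (∀ l : Fin k, l < j → ((Y l) * W).trace = 0) ∧ ((Y j) * W).trace ≠ 0)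

/-- The first `s` rows and columns of `W` vanish. -/
def LeadingZero {n : ℕ} (s : ℕ) (W : Matrix (Fin n) (Fin n) ℝ) : Prop :=
  ∀ a b : Fin n, a.val < s → W a b = 0 ∧ W b a = 0

theorem LeadingZero.mono {n s t : ℕ} (hst : s ≤ t) {W : Matrix (Fin n) (Fin n) ℝ}
    (h : LeadingZero t W) : LeadingZero s W :=
  fun a b ha => h a b (by omega)

theorem eq_zero_of_forall_nonneg_add_mul {a b : ℝ} (h : ∀ t : ℝ, 0 ≤ a + t * b) : b = 0 := by
  by_contra hb
  have h' := h (-(a + 1) / b)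
  rw [div_mul_cancel₀ _ hb] at h'
  linarith

theorem single_add_single_dotProduct_mulVec {ι : Type*} [Fintype ι] [DecidableEq ι]
    (M : Matrix ι ι ℝ) (p q : ι) (x y : ℝ) :
    (Pi.single p x + Pi.single q y) ⬝ᵥ (M *ᵥ (Pi.single p x + Pi.single q y)) =
      x * x * M p p + x * y * (M p q + M q p) + y * y * M q q := by
  simp [mulVec_add, add_dotProduct, dotProduct_add, mulVec_single]
  ring

/-- A vanishing diagonal entry of a positive semidefinite matrix forces its row to vanish. -/
theorem Matrix.PosSemidef.apply_eq_zero_of_diag_eq_zero_s15 {ι : Type*} [Fintype ι] [DecidableEq ι]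
    {W : Matrix ι ι ℝ} (hW : W.PosSemidef) {p : ι} (hp : W p p = 0) (q : ι) :
    W p q = 0 ∧ W q p = 0 := by
  have hsymm : W q p = W p q := by simpa using hW.isHermitian.apply p q
  have h0 : W p q + W q p = 0 := by
    refine eq_zero_of_forall_nonneg_add_mul (a := W q q) fun t => ?_
    have h := hW.dotProduct_mulVec_nonneg (Pi.single p t + Pi.single q 1)
    rw [star_trivial, single_add_single_dotProduct_mulVec, hp] at h
    linarith
  constructor <;> linarith

theorem trace_mul_eq_sum {n : ℕ} (Y W : Matrix (Fin n) (Fin n) ℝ) :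
    (Y * W).trace = ∑ a, ∑ b, Y a b * W b a := by
  simp [Matrix.trace, Matrix.mul_apply]

/-- If `Y` is nonnegative on the face of matrices with `s` leading zero rows and `Y q q = 0`,
then the part of row `q` of `Y` seen by the face vanishes. -/
theorem apply_add_apply_eq_zero_of_nonneg_on_face {n s : ℕ} {Y : Matrix (Fin n) (Fin n) ℝ}
    (hY : ∀ W : Matrix (Fin n) (Fin n) ℝ, W.PosSemidef → LeadingZero s W → 0 ≤ (Y * W).trace)
    {p q : Fin n} (hp : s ≤ p.val) (hq : s ≤ q.val) (hqq : Y q q = 0) :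
    Y p q + Y q p = 0 := by
  refine eq_zero_of_forall_nonneg_add_mul (a := Y p p) fun t => ?_
  set v : Fin n → ℝ := Pi.single p 1 + Pi.single q t with hv
  have hv0 : ∀ a : Fin n, a.val < s → v a = 0 := by
    intro a ha
    have hap : a ≠ p := by rintro rfl; omega
    have haq : a ≠ q := by rintro rfl; omega
    simp [hv, hap, haq]
  have h := hY (vecMulVec v v) (by simpa using posSemidef_vecMulVec_self_star v)
    (fun a b ha => by simp [vecMulVec_apply, hv0 a ha])
  rw [mul_vecMulVec, trace_vecMulVec, dotProduct_comm, hv,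
    single_add_single_dotProduct_mulVec, hqq] at h
  linarith

/-- If, on the indices from `s` on, `Y` is `c` times a diagonal projection onto the indices
below `s'`, and `Y` does not vanish on the face with `s` leading zeros, then `Y` exposes the
face with `s'` leading zeros. -/
theorem trace_eq_zero_iff_leadingZero {n s s' : ℕ} {Y : Matrix (Fin n) (Fin n) ℝ} {c : ℝ}
    (hs : s ≤ s')
    (hY : ∀ a b : Fin n, s ≤ a.val → s ≤ b.val →
      Y a b = if a = b ∧ a.val < s' then c else 0)
    (hne : ∃ W : Matrix (Fin n) (Fin n) ℝ, LeadingZero s W ∧ (Y * W).trace ≠ 0)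
    {W : Matrix (Fin n) (Fin n) ℝ} (hW : W.PosSemidef) :
    LeadingZero s W ∧ (Y * W).trace = 0 ↔ LeadingZero s' W := by
  have htr : ∀ V : Matrix (Fin n) (Fin n) ℝ, LeadingZero s V →
      (Y * V).trace = c * ∑ a : Fin n, if a.val < s' then V a a else 0 := by
    intro V hV
    rw [trace_mul_eq_sum, Finset.mul_sum]
    refine Finset.sum_congr rfl fun a _ => ?_
    rw [Finset.sum_eq_single a]
    · by_cases ha : a.val < s
      · simp [(hV a a ha).1]
      · rw [hY a a (by omega) (by omega)]
        simp
    · intro b _ hb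
      by_cases ha : a.val < s
      · simp [(hV a b ha).2]
      · by_cases hb' : b.val < s
        · simp [(hV b a hb').1]
        · rw [hY a b (by omega) (by omega)]
          simp [hb.symm]
    · simp
  have hc : c ≠ 0 := by
    rintro rfl
    obtain ⟨V, hV, hV0⟩ := hne
    exact hV0 (by rw [htr V hV, zero_mul])
  constructor
  · rintro ⟨hW0, ht⟩ a b ha
    refine hW.apply_eq_zero_of_diag_eq_zero_s15 ?_ b
    rw [htr W hW0, mul_eq_zero, or_iff_right hc, Finset.sum_eq_zero_iff_of_nonneg] at ht
    · simpa [ha] using ht a (Finset.mem_univ a)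
    · intro x _
      split_ifs
      exacts [hW.diag_nonneg, le_rfl]
  · intro h
    refine ⟨h.mono hs, ?_⟩
    rw [htr W (h.mono hs), Finset.sum_eq_zero, mul_zero]
    intro a _
    split_ifs with ha
    exacts [(h a a ha).1, rfl]

/-- The linear relations between entries satisfied by all matrices in the span of
`B, A₂, …, A_m`. -/
structure DoubleSpanRel (m : ℕ) (Y : Matrix (Fin (2 * m + 1)) (Fin (2 * m + 1)) ℝ) : Prop where
  symm : ∀ a b, Y a b = Y b a
  last : ∀ a, a.val = 2 * m → Y a a = 0
  offDiag : ∀ a b, a ≠ b → a.val ≠ 2 * m → b.val ≠ 2 * m → Y a b = 0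
  diagMid : ∀ a b, a.val = 0 → b.val = m → Y b b = Y a a
  diagLeft : ∀ a b c l, a.val = 0 → 1 ≤ b.val → b.val < m → c.val + 1 = b.val →
    l.val = 2 * m → Y b b = Y a a + Y c l
  diagRight : ∀ b c l, m < b.val → b.val < 2 * m → c.val + 1 = b.val → l.val = 2 * m →
    Y b b = (if b.val = 2 * m - 1 then -1 else 1) * Y c l

theorem doubleSpanRel_doubleB {m : ℕ} (hm : 2 ≤ m) : DoubleSpanRel m (doubleB m) where
  symm a b := by
    simp only [doubleB, of_apply]
    exact if_congr (by constructor <;> (rintro ⟨rfl, h⟩; exact ⟨rfl, h⟩)) rfl rfl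
  last a ha := by
    simp only [doubleB, of_apply]
    exact if_neg (by omega)
  offDiag a b hab _ _ := by simp [doubleB, hab]
  diagMid a b ha hb := by simp [doubleB, ha, hb]
  diagLeft a b c l ha hb hb' hc hl := by
    simp only [doubleB, of_apply, Fin.ext_iff]
    grind
  diagRight b c l hb hb' hc hl := by
    simp only [doubleB, of_apply, Fin.ext_iff]
    grind

theorem doubleSpanRel_doubleA {m : ℕ} (hm : 2 ≤ m) {k : Fin m} (hk : 1 ≤ k.val) :
    DoubleSpanRel m (doubleA m k) := by
  obtain ⟨k, hkm⟩ := k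
  have hk0 : k ≠ 0 := by simp at hk; omega
  simp only at hk
  constructor
  all_goals
    intros
    simp only [doubleA, Eij, if_neg hk0, ne_eq, Fin.ext_iff] at *
    by_cases hlast : k = m - 1
    all_goals
      simp only [hlast, if_true, if_false, Matrix.add_apply, Matrix.sub_apply, of_apply,
        and_self, or_self]
      grind (splits := 30)

theorem doubleSpanRel_of_mem_span {m : ℕ} (hm : 2 ≤ m)
    {Y : Matrix (Fin (2 * m + 1)) (Fin (2 * m + 1)) ℝ}
    (hY : Y ∈ Submodule.span ℝ
      (insert (doubleB m) {M | ∃ k : Fin m, 1 ≤ k.val ∧ M = doubleA m k})) :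
    DoubleSpanRel m Y := by
  induction hY using Submodule.span_induction with
  | mem x hx =>
    rcases hx with rfl | ⟨k, hk, rfl⟩
    exacts [doubleSpanRel_doubleB hm, doubleSpanRel_doubleA hm hk]
  | zero => constructor <;> intros <;> simp
  | add x y _ _ hx hy =>
    constructor <;> intros <;> simp only [Matrix.add_apply]
    · rw [hx.symm, hy.symm]
    · rw [hx.last _ ‹_›, hy.last _ ‹_›, add_zero]
    · rw [hx.offDiag _ _ ‹_› ‹_› ‹_›, hy.offDiag _ _ ‹_› ‹_› ‹_›, add_zero]
    · rw [hx.diagMid _ _ ‹_› ‹_›, hy.diagMid _ _ ‹_› ‹_›]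
    · rw [hx.diagLeft _ _ _ _ ‹_› ‹_› ‹_› ‹_› ‹_›, hy.diagLeft _ _ _ _ ‹_› ‹_› ‹_› ‹_› ‹_›]
      ring
    · rw [hx.diagRight _ _ _ ‹_› ‹_› ‹_› ‹_›, hy.diagRight _ _ _ ‹_› ‹_› ‹_› ‹_›]
      ring
  | smul r x _ hx =>
    constructor <;> intros <;> simp only [Matrix.smul_apply, smul_eq_mul]
    · rw [hx.symm]
    · rw [hx.last _ ‹_›, mul_zero]
    · rw [hx.offDiag _ _ ‹_› ‹_› ‹_›, mul_zero]
    · rw [hx.diagMid _ _ ‹_› ‹_›]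
    · rw [hx.diagLeft _ _ _ _ ‹_› ‹_› ‹_› ‹_› ‹_›]
      ring
    · rw [hx.diagRight _ _ _ ‹_› ‹_› ‹_› ‹_›]
      ring

namespace DoubleSpanRel

variable {m : ℕ} {Y : Matrix (Fin (2 * m + 1)) (Fin (2 * m + 1)) ℝ}

theorem apply_last_eq_zero (hY : DoubleSpanRel m Y) {s : ℕ} (hs : s ≤ 2 * m)
    (hdual : ∀ W : Matrix (Fin (2 * m + 1)) (Fin (2 * m + 1)) ℝ, W.PosSemidef →
      LeadingZero s W → 0 ≤ (Y * W).trace)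
    {p l : Fin (2 * m + 1)} (hp : s ≤ p.val) (hl : l.val = 2 * m) : Y p l = 0 := by
  have h := apply_add_apply_eq_zero_of_nonneg_on_face hdual hp (by omega) (hY.last l hl)
  rw [hY.symm l p] at h
  linarith

theorem apply_eq_zero_of_ne (hY : DoubleSpanRel m Y) {s : ℕ} (hs : s ≤ 2 * m)
    (hdual : ∀ W : Matrix (Fin (2 * m + 1)) (Fin (2 * m + 1)) ℝ, W.PosSemidef →
      LeadingZero s W → 0 ≤ (Y * W).trace)
    {a b : Fin (2 * m + 1)} (ha : s ≤ a.val) (hb : s ≤ b.val) (hab : a ≠ b) : Y a b = 0 := by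
  by_cases hb' : b.val = 2 * m
  · exact hY.apply_last_eq_zero hs hdual ha hb'
  by_cases ha' : a.val = 2 * m
  · rw [hY.symm]
    exact hY.apply_last_eq_zero hs hdual hb ha'
  · exact hY.offDiag a b hab ha' hb'

theorem diag_eq_zero (hY : DoubleSpanRel m Y) {s : ℕ} (hs : s ≤ 2 * m)
    (hdual : ∀ W : Matrix (Fin (2 * m + 1)) (Fin (2 * m + 1)) ℝ, W.PosSemidef →
      LeadingZero s W → 0 ≤ (Y * W).trace)
    {a : Fin (2 * m + 1)} (ha : s < a.val) (ham : m < a.val) : Y a a = 0 := by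
  by_cases ha' : a.val = 2 * m
  · exact hY.last a ha'
  · rw [hY.diagRight a ⟨a.val - 1, by omega⟩ (Fin.last _) ham (by omega)
        (by simp only; omega) rfl,
      hY.apply_last_eq_zero (l := Fin.last _) hs hdual (by simp only; omega) rfl, mul_zero]

theorem apply_eq_of_dual (hY : DoubleSpanRel m Y)
    (hdual : ∀ W : Matrix (Fin (2 * m + 1)) (Fin (2 * m + 1)) ℝ, W.PosSemidef →
      LeadingZero 0 W → 0 ≤ (Y * W).trace) (a b : Fin (2 * m + 1)) :
    Y a b = if a = b ∧ a.val < m + 1 then Y 0 0 else 0 := by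
  by_cases hab : a = b
  · subst hab
    by_cases ha : a.val < m + 1
    · simp only [ha, and_self, if_true]
      by_cases ham : a.val = m
      · exact hY.diagMid 0 a rfl ham
      by_cases ha0 : a.val = 0
      · rw [show a = 0 from Fin.ext ha0]
      · rw [hY.diagLeft 0 a ⟨a.val - 1, by omega⟩ (Fin.last _) rfl (by omega) (by omega)
            (by simp only; omega) rfl,
          hY.apply_last_eq_zero (l := Fin.last _) (Nat.zero_le _) hdual (Nat.zero_le _) rfl,
          add_zero]
    · simp only [ha, and_false, if_false]
      exact hY.diag_eq_zero (Nat.zero_le _) hdual (by omega) (by omega)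
  · simp only [hab, false_and, if_false]
    exact hY.apply_eq_zero_of_ne (Nat.zero_le _) hdual (Nat.zero_le _) (Nat.zero_le _) hab

theorem apply_eq_of_dual_on_face (hY : DoubleSpanRel m Y) (s : Fin (2 * m + 1)) (hs : m ≤ s.val)
    (hdual : ∀ W : Matrix (Fin (2 * m + 1)) (Fin (2 * m + 1)) ℝ, W.PosSemidef →
      LeadingZero s.val W → 0 ≤ (Y * W).trace) (a b : Fin (2 * m + 1))
    (ha : s.val ≤ a.val) (hb : s.val ≤ b.val) :
    Y a b = if a = b ∧ a.val < s.val + 1 then Y s s else 0 := by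
  by_cases hab : a = b
  · subst hab
    by_cases has : a.val < s.val + 1
    · rw [show a = s from Fin.ext (by omega)]
      simp
    · simp only [has, and_false, if_false]
      exact hY.diag_eq_zero (by omega) hdual (by omega) (by omega)
  · simp only [hab, false_and, if_false]
    exact hY.apply_eq_zero_of_ne (by omega) hdual ha hb hab

end DoubleSpanRel

theorem forall_lt_trace_eq_zero_iff_leadingZero {m i : ℕ}
    {Y : Fin i → Matrix (Fin (2 * m + 1)) (Fin (2 * m + 1)) ℝ}
    (hrel : ∀ j, DoubleSpanRel m (Y j)) (hsfr : IsStrictFRSeq Y) (h2 : i ≤ m) (t : ℕ)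
    (ht : t < i) {W : Matrix (Fin (2 * m + 1)) (Fin (2 * m + 1)) ℝ} (hW : W.PosSemidef) :
    (∀ j : Fin i, j.val < t + 1 → (Y j * W).trace = 0) ↔ LeadingZero (m + (t + 1)) W := by
  have hsplit : ∀ t (ht : t < i) (V : Matrix (Fin (2 * m + 1)) (Fin (2 * m + 1)) ℝ),
      (∀ j : Fin i, j.val < t + 1 → (Y j * V).trace = 0) ↔
        (∀ j : Fin i, j.val < t → (Y j * V).trace = 0) ∧ (Y ⟨t, ht⟩ * V).trace = 0 := by
    intro t ht V
    refine ⟨fun h => ⟨fun j hj => h j (by omega), h _ (Nat.lt_succ_self t)⟩, ?_⟩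
    rintro ⟨h, h'⟩ j hj
    rcases Nat.lt_succ_iff_lt_or_eq.mp hj with hlt | heq
    · exact h j hlt
    · rwa [show j = ⟨t, ht⟩ from Fin.ext heq]
  have hstep : ∀ {s : ℕ} (t : ℕ) (ht : t < i) (hface : ∀ {V : Matrix (Fin (2 * m + 1)) (Fin (2 * m + 1)) ℝ},
        V.PosSemidef → ((∀ j : Fin i, j.val < t → (Y j * V).trace = 0) ↔ LeadingZero s V)),
      (∀ V : Matrix (Fin (2 * m + 1)) (Fin (2 * m + 1)) ℝ, V.PosSemidef →
        LeadingZero s V → 0 ≤ (Y ⟨t, ht⟩ * V).trace) ∧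
      ∃ V, LeadingZero s V ∧ (Y ⟨t, ht⟩ * V).trace ≠ 0 := by
    intro s t ht hface
    obtain ⟨hdual, V, hV, hV0, hne⟩ := hsfr ⟨t, ht⟩
    exact ⟨fun V hV hs => hdual V hV fun l hl => (hface hV).2 hs l hl,
      V, (hface hV).1 fun l hl => hV0 l hl, hne⟩
  induction t generalizing W with
  | zero =>
    have hface : ∀ {V : Matrix (Fin (2 * m + 1)) (Fin (2 * m + 1)) ℝ}, V.PosSemidef →
        ((∀ j : Fin i, j.val < 0 → (Y j * V).trace = 0) ↔ LeadingZero 0 V) :=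
      fun _ => ⟨fun _ _ _ h => absurd h (Nat.not_lt_zero _),
        fun _ _ h => absurd h (Nat.not_lt_zero _)⟩
    obtain ⟨hdual, hne⟩ := hstep 0 ht hface
    rw [hsplit 0 ht, hface hW]
    exact trace_eq_zero_iff_leadingZero (Nat.zero_le _)
      (fun a b _ _ => (hrel _).apply_eq_of_dual hdual a b) hne hW
  | succ t ih =>
    obtain ⟨hdual, hne⟩ := hstep (t + 1) ht (ih (Nat.lt_of_succ_lt ht))
    refine (hsplit (t + 1) ht W).trans
      ((and_congr_left' (ih (Nat.lt_of_succ_lt ht) hW)).trans ?_)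
    exact trace_eq_zero_iff_leadingZero (by omega)
      ((hrel _).apply_eq_of_dual_on_face ⟨m + (t + 1), by omega⟩ (by simp) hdual) hne hW

/-- (Key claim for the singularity degree of the homogeneous dual of the
double-sequence SDP.) For the double-sequence SDP with parameter `m ≥ 2`
(`n = 2m+1`), if `1 ≤ i ≤ m` and `(Y₁,…,Y_i)` is a strict facial reduction
sequence for the psd cone whose members all lie in the span of `{B, A₂,…,A_m}`,
then the psd matrices `W` with `trace(Yⱼ W) = 0` for all `j` are exactly those
whose first `m+i` rows and columns are zero: `0_{m+i} ⊕ PSD^{m-i+1}`. -/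
theorem doubleSeq_strictFR {m i : ℕ} (hm : 2 ≤ m) (h1 : 1 ≤ i) (h2 : i ≤ m)
    (Y : Fin i → Matrix (Fin (2 * m + 1)) (Fin (2 * m + 1)) ℝ)
    (hspan : ∀ j, Y j ∈ Submodule.span ℝ
      (insert (doubleB m) {M | ∃ k : Fin m, 1 ≤ k.val ∧ M = doubleA m k}))
    (hsfr : IsStrictFRSeq Y) :
    ∀ W : Matrix (Fin (2 * m + 1)) (Fin (2 * m + 1)) ℝ,
      (W.PosSemidef ∧ ∀ j, ((Y j) * W).trace = 0) ↔
      (W.PosSemidef ∧ ∀ a b : Fin (2 * m + 1), a.val < m + i →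
        W a b = 0 ∧ W b a = 0) := by
  intro W
  refine and_congr_right fun hW => ?_
  have h := forall_lt_trace_eq_zero_iff_leadingZero
    (fun j => doubleSpanRel_of_mem_span hm (hspan j)) hsfr h2 (i - 1) (by omega) hW
  rw [Nat.sub_add_cancel h1] at h
  exact ⟨fun hj => h.1 fun j _ => hj j, fun h0 j => h.2 h0 j j.isLt⟩
end

section
/- (Concretized second half of the theorem that maximal singularity degree of the homogeneous dual implies zero duality gap.) Let (B, A₁,…,A_m) be a regularized facial reduction sequence for the n×n psd cone with block sizes r₀, r₁,…,r_m, so in particular B = I_{r₀} ⊕ 0. Define the index sets I₀ = {1,…,r₀}, I_k = {r₀+…+r_{k−1}+1, …, r₀+…+r_k} for k = 1,…,m, and I_{m+1} = {r₀+…+r_m+1, …, n}. Assume that for every i = 1,…,m the submatrix of A_i with rows in I_{i−1} and columns in I_{i+1} ∪ … ∪ I_{m+1} is nonzero. Then: (a) the only positive semidefinite matrix in the linear span of {A₁,…,A_m} is the zero matrix; (b) A₁,…,A_m are linearly independent; (c) for every c ∈ ℝ^m the dual (D) is strictly feasible, i.e., there exists a positive definite Y with trace(AᵢY) = cᵢ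 for all i; and consequently (d) for every c ∈ ℝ^m, val(P) = val(D) = 0. -/
open Matrix

/-- `partialSum r k = r 0 + r 1 + ⋯ + r (k-1)`. -/
def partialSum (r : ℕ → ℕ) (k : ℕ) : ℕ := ∑ j ∈ Finset.range k, r j

/-- A matrix `M` is a step of a regularized facial reduction sequence with prior
rows `lo` and identity block ending at row `hi`. -/
def IsRegFRStep (n : ℕ) (M : Matrix (Fin n) (Fin n) ℝ) (lo hi : ℕ) : Prop :=
  M.IsSymm ∧ ∀ a b : Fin n, lo ≤ a.val → lo ≤ b.val →
    M a b = if a = b ∧ a.val < hi then 1 else 0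

/-- A vanishing diagonal entry of a psd matrix forces the off-diagonal entries of its column
to vanish. -/
lemma Matrix.PosSemidef.apply_eq_zero_of_diag_eq_zero_s17 {n : ℕ} {M : Matrix (Fin n) (Fin n) ℝ}
    (hM : M.PosSemidef) {b : Fin n} (hb : M b b = 0) (a : Fin n) : M a b = 0 := by
  have hdet := (hM.submatrix ![a, b]).det_nonneg
  have hsymm : M b a = M a b := hM.isHermitian.apply a b
  simp only [det_fin_two, submatrix_apply, cons_val_zero, cons_val_one, hb, hsymm] at hdet
  nlinarith [sq_nonneg (M a b)]

/-- Changing the entries `(a, b)`, `(b, a)` and `(b, b)` of a positive definite matrix so that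
`(a, b)` moves by a prescribed amount `t` and positive definiteness is kept. -/
lemma exists_posDef_update {n : ℕ} {Y : Matrix (Fin n) (Fin n) ℝ} {ε : ℝ} (hε : 0 < ε)
    (hY : (Y - ε • (1 : Matrix (Fin n) (Fin n) ℝ)).PosSemidef) (a b : Fin n) (t : ℝ) :
    ∃ (W : Matrix (Fin n) (Fin n) ℝ) (d : ℝ),
      (W - (ε / 2) • (1 : Matrix (Fin n) (Fin n) ℝ)).PosSemidef ∧
      ∀ A : Matrix (Fin n) (Fin n) ℝ, A.IsSymm →
        (A * W).trace = (A * Y).trace + 2 * t * A a b + d * A b b := by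
  set u : Fin n → ℝ := Pi.single a 1 + Pi.single b (2 * t / ε) with hu
  have huu : (vecMulVec u u).PosSemidef := by
    simpa using posSemidef_vecMulVec_self_star u
  have hdiag : (1 - single a a (1 : ℝ)).PosSemidef := by
    have h : (1 - single a a (1 : ℝ)) = diagonal (fun i => if i = a then 0 else 1) := by
      ext i j
      by_cases hij : i = j
      · subst hij
        by_cases hia : i = a
        · simp [hia]
        · simp [hia, Ne.symm hia]
      · have : ¬ (a = i ∧ a = j) := fun h => hij (h.1.symm.trans h.2)
        simp [hij, this]
    rw [h]
    refine PosSemidef.diagonal fun i => ?_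
    dsimp only [Pi.zero_apply]
    split_ifs <;> norm_num
  have hε2 : 0 ≤ ε / 2 := by positivity
  refine ⟨Y + (ε / 2) • (vecMulVec u u - single a a 1), 2 * t ^ 2 / ε, ?_, fun A hA => ?_⟩
  · have h := (hY.add (hdiag.smul hε2)).add (huu.smul hε2)
    convert h using 1
    module
  · have hsymm : A b a = A a b := hA.apply a b
    have hquad : (A * vecMulVec u u).trace
        = A a a + 2 * (2 * t / ε) * A a b + (2 * t / ε) ^ 2 * A b b := by
      rw [mul_vecMulVec, trace_vecMulVec, hu]
      simp only [mulVec_add, mulVec_single, add_dotProduct, dotProduct_add]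
      simp [hsymm]
      ring
    have haa : (A * single a a (1 : ℝ)).trace = A a a := by
      simp [trace_mul_single]
    simp only [mul_add, mul_sub, trace_add, trace_sub, Matrix.mul_smul, trace_smul, hquad, haa,
      smul_eq_mul]
    field_simp
    ring

lemma partialSum_mono (r : ℕ → ℕ) : Monotone (partialSum r) := fun _ _ h =>
  Finset.sum_le_sum_of_subset (Finset.range_mono h)

/-- A psd matrix of the form `B + ∑ xᵢ Aᵢ` has `x = 0` when `B` is diagonal and supported on
the first block. -/
lemma coeff_eq_zero_of_posSemidef {n m : ℕ} (r : ℕ → ℕ)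
    (B : Matrix (Fin n) (Fin n) ℝ) (A : Fin m → Matrix (Fin n) (Fin n) ℝ)
    (hBoff : ∀ a b, a ≠ b → B a b = 0)
    (hBdiag : ∀ b : Fin n, partialSum r 1 ≤ b.val → B b b = 0)
    (hA : ∀ k : Fin m, IsRegFRStep n (A k) (partialSum r (k.val + 1)) (partialSum r (k.val + 2)))
    (hnonzero : ∀ k : Fin m, ∃ a b : Fin n,
      partialSum r k.val ≤ a.val ∧ a.val < partialSum r (k.val + 1) ∧
      partialSum r (k.val + 2) ≤ b.val ∧ A k a b ≠ 0)
    (x : Fin m → ℝ) (hx : (B + ∑ i, x i • A i).PosSemidef) : x = 0 := by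
  by_contra hne
  obtain ⟨k₀, hk₀⟩ := Function.ne_iff.mp hne
  obtain ⟨k, hk, hmax⟩ := (Finset.univ.filter fun k => x k ≠ 0).exists_maximal
    ⟨k₀, by simpa using hk₀⟩
  have hxk : x k ≠ 0 := by simpa using hk
  have hlarge : ∀ j, k < j → x j = 0 := fun j hj => by
    by_contra h
    exact absurd (hmax (by simpa using h) hj.le) (not_le.mpr hj)
  obtain ⟨a, b, ha, hab, hb, hAab⟩ := hnonzero k
  have hmono := partialSum_mono r
  have hsteps : partialSum r (k.val + 1) ≤ partialSum r (k.val + 2) := hmono (by omega)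
  have hne_ab : a ≠ b := fun h => by subst h; omega
  have hcol : ∀ i : Fin n, partialSum r k.val ≤ i.val →
      ∀ j, j ≠ k → x j * A j i b = 0 := by
    intro i hi j hj
    rcases lt_or_gt_of_ne hj with hlt | hgt
    · have h1 : partialSum r (j.val + 1) ≤ partialSum r k.val := hmono hlt
      have h2 : partialSum r (j.val + 2) ≤ partialSum r (k.val + 1) :=
        hmono (Nat.succ_le_succ hlt)
      have h3 : partialSum r k.val ≤ partialSum r (k.val + 1) := hmono (by omega)
      rw [(hA j).2 i b (by omega) (by omega), if_neg, mul_zero]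
      rintro ⟨rfl, h⟩
      omega
    · rw [hlarge j hgt, zero_mul]
  have hentry : ∀ i : Fin n, partialSum r k.val ≤ i.val →
      (B + ∑ j, x j • A j) i b = B i b + x k * A k i b := by
    intro i hi
    rw [Matrix.add_apply, Matrix.sum_apply]
    simp only [Matrix.smul_apply, smul_eq_mul]
    rw [Finset.sum_eq_single k (fun j _ hj => hcol i hi j hj) (by simp)]
  have hbb : (B + ∑ j, x j • A j) b b = 0 := by
    have h1 : partialSum r 1 ≤ partialSum r (k.val + 2) := hmono (by omega)
    have h2 : partialSum r k.val ≤ partialSum r (k.val + 2) := hmono (by omega)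
    rw [hentry b (by omega), hBdiag b (by omega), (hA k).2 b b (by omega) (by omega),
      if_neg (by omega)]
    simp
  have hzero := hx.apply_eq_zero_of_diag_eq_zero_s17 hbb a
  rw [hentry a ha, hBoff a b hne_ab, zero_add] at hzero
  exact (mul_ne_zero hxk hAab) hzero

/-- Strictly feasible dual solutions with objective value `η * trace B` exist for every
`η > 0`. -/
lemma exists_strictly_feasible {n m : ℕ} (r : ℕ → ℕ)
    (B : Matrix (Fin n) (Fin n) ℝ) (A : Fin m → Matrix (Fin n) (Fin n) ℝ)
    (hB : IsRegFRStep n B 0 (partialSum r 1))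
    (hA : ∀ k : Fin m, IsRegFRStep n (A k) (partialSum r (k.val + 1)) (partialSum r (k.val + 2)))
    (hnonzero : ∀ k : Fin m, ∃ a b : Fin n,
      partialSum r k.val ≤ a.val ∧ a.val < partialSum r (k.val + 1) ∧
      partialSum r (k.val + 2) ≤ b.val ∧ A k a b ≠ 0)
    (c : Fin m → ℝ) {η : ℝ} (hη : 0 < η) :
    ∃ Y : Matrix (Fin n) (Fin n) ℝ, Y.PosDef ∧ (∀ i, ((A i) * Y).trace = c i) ∧
      (B * Y).trace = η * B.trace := by
  have hmono := partialSum_mono r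
  have key : ∀ k ≤ m, ∃ (Y : Matrix (Fin n) (Fin n) ℝ) (ε : ℝ), 0 < ε ∧
      (Y - ε • (1 : Matrix (Fin n) (Fin n) ℝ)).PosSemidef ∧
      (∀ i : Fin m, i.val < k → ((A i) * Y).trace = c i) ∧ (B * Y).trace = η * B.trace := by
    intro k
    induction k with
    | zero =>
      intro _
      exact ⟨η • 1, η, hη, by simpa using PosSemidef.zero, by simp, by simp⟩
    | succ k ih =>
      intro hk
      obtain ⟨Y, ε, hε, hY, hfeas, hobj⟩ := ih (by omega)
      obtain ⟨a, b, ha, hab, hb, hAab⟩ := hnonzero ⟨k, hk⟩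
      dsimp only at ha hab hb
      have h01 : partialSum r k ≤ partialSum r (k + 1) := hmono (by omega)
      have h12 : partialSum r (k + 1) ≤ partialSum r (k + 2) := hmono (by omega)
      have hne : a ≠ b := fun h => by subst h; omega
      obtain ⟨W, d, hW, htr⟩ := exists_posDef_update hε hY a b
        ((c ⟨k, hk⟩ - (A ⟨k, hk⟩ * Y).trace) / (2 * A ⟨k, hk⟩ a b))
      refine ⟨W, ε / 2, by positivity, hW, fun i hi => ?_, ?_⟩
      · rw [htr _ (hA i).1]
        rcases Nat.lt_succ_iff_lt_or_eq.mp hi with hlt | heq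
        · have h1 : partialSum r (i.val + 1) ≤ partialSum r k := hmono hlt
          have h2 : partialSum r (i.val + 2) ≤ partialSum r (k + 1) :=
            hmono (Nat.succ_le_succ hlt)
          rw [(hA i).2 a b (by omega) (by omega), (hA i).2 b b (by omega) (by omega),
            if_neg (fun h => hne h.1), if_neg (by omega), hfeas i hlt]
          ring
        · obtain rfl : i = ⟨k, hk⟩ := Fin.ext heq
          rw [(hA ⟨k, hk⟩).2 b b (by dsimp only; omega) (by dsimp only; omega),
            if_neg (by dsimp only; omega)]
          field_simp
          ring
      · have h1 : partialSum r 1 ≤ partialSum r (k + 2) := hmono (by omega)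
        rw [htr _ hB.1, hobj, hB.2 a b (Nat.zero_le _) (Nat.zero_le _),
          hB.2 b b (Nat.zero_le _) (Nat.zero_le _), if_neg (fun h => hne h.1),
          if_neg (by omega)]
        ring
  obtain ⟨Y, ε, hε, hY, hfeas, hobj⟩ := key m le_rfl
  refine ⟨Y, ?_, fun i => hfeas i i.isLt, hobj⟩
  simpa using PosDef.posSemidef_add hY (PosDef.one.smul hε)

/-- (Concretized second half of: maximal singularity degree of the homogeneous
dual implies zero duality gap.) If `(B, A₁,…,A_m)` is a regularized facial
reduction sequence with block sizes `r₀,…,r_m` such that for every `i` the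
submatrix of `Aᵢ` with rows in `I_{i-1}` and columns in `I_{i+1} ∪ ⋯ ∪ I_{m+1}`
is nonzero, then: (a) the only psd matrix in the span of the `Aᵢ` is `0`;
(b) the `Aᵢ` are linearly independent; (c) for every `c` the dual (D) is strictly
feasible; and (d) for every `c`, `val(P) = val(D) = 0`. -/
theorem regFR_zero_gap {n m : ℕ} (r : ℕ → ℕ)
    (hsum : partialSum r (m + 1) ≤ n)
    (B : Matrix (Fin n) (Fin n) ℝ) (A : Fin m → Matrix (Fin n) (Fin n) ℝ)
    (hB : IsRegFRStep n B 0 (partialSum r 1))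
    (hA : ∀ k : Fin m, IsRegFRStep n (A k) (partialSum r (k.val + 1)) (partialSum r (k.val + 2)))
    (hnonzero : ∀ k : Fin m, ∃ a b : Fin n,
      partialSum r k.val ≤ a.val ∧ a.val < partialSum r (k.val + 1) ∧
      partialSum r (k.val + 2) ≤ b.val ∧ A k a b ≠ 0) :
    (∀ M ∈ Submodule.span ℝ (Set.range A), M.PosSemidef → M = 0) ∧
    (LinearIndependent ℝ A) ∧
    (∀ c : Fin m → ℝ, ∃ Y : Matrix (Fin n) (Fin n) ℝ, Y.PosDef ∧
      ∀ i, ((A i) * Y).trace = c i) ∧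
    (∀ c : Fin m → ℝ, valP A B c = 0 ∧ valD A B c = 0) := by
  have hBoff : ∀ a b, a ≠ b → B a b = 0 := fun a b hab => by
    rw [hB.2 a b (Nat.zero_le _) (Nat.zero_le _), if_neg (fun h => hab h.1)]
  have hBdiag : ∀ b : Fin n, partialSum r 1 ≤ b.val → B b b = 0 := fun b hb => by
    rw [hB.2 b b (Nat.zero_le _) (Nat.zero_le _), if_neg (by omega)]
  have hBentry : ∀ b, 0 ≤ B b b := fun b => by
    rw [hB.2 b b (Nat.zero_le _) (Nat.zero_le _)]
    split_ifs <;> norm_num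
  have hspan : ∀ x : Fin m → ℝ, (∑ i, x i • A i).PosSemidef → x = 0 := fun x hx =>
    coeff_eq_zero_of_posSemidef r 0 A (by simp) (by simp) hA hnonzero x (by simpa using hx)
  refine ⟨fun M hM hpsd => ?_, ?_, fun c => ?_, fun c => ⟨?_, ?_⟩⟩
  · obtain ⟨x, rfl⟩ := (Submodule.mem_span_range_iff_exists_fun ℝ).mp hM
    simp [hspan x hpsd]
  · rw [Fintype.linearIndependent_iff]
    intro x hx i
    exact congrFun (hspan x (hx ▸ PosSemidef.zero)) i
  · obtain ⟨Y, hY, hfeas, -⟩ := exists_strictly_feasible r B A hB hA hnonzero c one_pos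
    exact ⟨Y, hY, hfeas⟩
  · have hBpsd : B.PosSemidef := by
      have h : B = diagonal fun i => B i i := by
        ext i j
        by_cases hij : i = j
        · simp [hij]
        · simp [hij, hBoff i j hij]
      rw [h]
      exact PosSemidef.diagonal hBentry
    have hset : {x : Fin m → ℝ | (B - ∑ i, x i • A i).PosSemidef} = {0} := by
      ext x
      simp only [Set.mem_ofPred_eq, Set.mem_singleton_iff]
      constructor
      · intro hx
        have h := coeff_eq_zero_of_posSemidef r B A hBoff hBdiag hA hnonzero (-x)
          (by simpa [sub_eq_add_neg] using hx)
        simpa using h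
      · rintro rfl
        simpa using hBpsd
    simp [valP, hset]
  · have hobj : ∀ Y : Matrix (Fin n) (Fin n) ℝ, Y.PosSemidef → 0 ≤ (B * Y).trace := by
      intro Y hY
      refine Finset.sum_nonneg fun i _ => ?_
      rw [diag_apply, mul_apply, Finset.sum_eq_single i
        (fun j _ hj => by rw [hBoff i j hj.symm, zero_mul]) (by simp)]
      exact mul_nonneg (hBentry i) hY.diag_nonneg
    have htrace : 0 ≤ B.trace := Finset.sum_nonneg fun i _ => hBentry i
    refine le_antisymm (EReal.le_of_forall_lt_iff_le.mp fun δ hδ => ?_) (le_sInf ?_)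
    · have hδ' : 0 < δ := by exact_mod_cast hδ
      obtain ⟨Y, hY, hfeas, hval⟩ := exists_strictly_feasible r B A hB hA hnonzero c
        (η := δ / (B.trace + 1)) (by positivity)
      have hmem : Y ∈ {Y | Y.PosSemidef ∧ ∀ i, ((A i) * Y).trace = c i} := ⟨hY.posSemidef, hfeas⟩
      refine (sInf_le (Set.mem_image_of_mem _ hmem)).trans ?_
      rw [EReal.coe_le_coe_iff, hval, div_mul_eq_mul_div, div_le_iff₀ (by positivity)]
      nlinarith
    · rintro _ ⟨Y, ⟨hY, -⟩, rfl⟩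
      exact EReal.coe_nonneg.mpr (hobj Y hY)
end

section
/- (Congruence normal-form lemma.) Let r₁, r₂ ≥ 0 and let G be a real symmetric (r₁+r₂)×(r₁+r₂) matrix partitioned as G = [[G₁₁, G₁₂],[G₁₂ᵀ, G₂₂]] with G₁₁ an r₁×r₁ symmetric matrix and G₂₂ an r₂×r₂ positive semidefinite matrix. Then there exist an invertible matrix T ∈ ℝ^{(r₁+r₂)×(r₁+r₂)}, an integer 0 ≤ s ≤ r₂, a diagonal r₁×r₁ matrix Σ and a matrix W ∈ ℝ^{r₁×(r₂−s)} such that TᵀGT equals the block matrix [[Σ, 0, W],[0, I_s, 0],[Wᵀ, 0, 0]] with block sizes r₁, s, r₂−s, and moreover Tᵀ(I_{r₁} ⊕ 0_{r₂})T = I_{r₁} ⊕ 0_{r₂}. -/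
open Matrix

/-- Spectral theorem for real symmetric matrices, as a congruence by an orthogonal matrix. -/
theorem Matrix.IsSymm.exists_orthogonal_diagonalization {n : Type*} [Fintype n] [DecidableEq n]
    {S : Matrix n n ℝ} (hS : S.IsSymm) :
    ∃ (U : Matrix n n ℝ) (d : n → ℝ), Uᵀ * U = 1 ∧ Uᵀ * S * U = diagonal d := by
  have hH : S.IsHermitian := by
    rw [Matrix.IsHermitian, conjTranspose_eq_transpose_of_trivial]
    exact hS
  refine ⟨hH.eigenvectorUnitary, hH.eigenvalues, ?_, ?_⟩
  · have h := Unitary.coe_star_mul_self hH.eigenvectorUnitary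
    rwa [star_eq_conjTranspose, conjTranspose_eq_transpose_of_trivial] at h
  · have h := hH.conjStarAlgAut_star_eigenvectorUnitary
    rwa [Unitary.conjStarAlgAut_star_apply, star_eq_conjTranspose, conjTranspose_eq_transpose_of_trivial] at h

/-- Any predicate on `Fin n` becomes an initial segment after a permutation. -/
theorem Fin.exists_perm_lt_iff {n : ℕ} (p : Fin n → Prop) :
    ∃ (s : ℕ) (σ : Equiv.Perm (Fin n)), s ≤ n ∧ ∀ i, p (σ i) ↔ i.val < s := by
  classical
  have hs : Fintype.card {i // p i} ≤ n := by
    simpa using Fintype.card_subtype_le p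
  have hcard : Fintype.card {i : Fin n // i.val < Fintype.card {i // p i}} =
      Fintype.card {i // p i} := by
    rw [Fintype.card_subtype (fun i : Fin n => i.val < _), Fin.card_filter_val_lt]
    exact min_eq_right hs
  let f := Fintype.equivOfCardEq hcard
  refine ⟨_, f.extendSubtype, hs, fun i => ⟨fun h => ?_, fun h => f.extendSubtype_mem i h⟩⟩
  by_contra hi
  exact f.extendSubtype_not_mem i hi h

/-- Sylvester's law of inertia (existence part) for real positive semidefinite matrices. -/
theorem Matrix.PosSemidef.exists_congruence_diagonal {n : ℕ} {P : Matrix (Fin n) (Fin n) ℝ}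
    (hP : P.PosSemidef) :
    ∃ (V : Matrix (Fin n) (Fin n) ℝ) (s : ℕ), IsUnit V ∧ s ≤ n ∧
      Vᵀ * P * V = diagonal fun i => if i.val < s then 1 else 0 := by
  have hsymm : P.IsSymm := by
    have h := hP.isHermitian
    rwa [Matrix.IsHermitian, conjTranspose_eq_transpose_of_trivial] at h
  obtain ⟨Q, d, hQ, hd⟩ := hsymm.exists_orthogonal_diagonalization
  have hd0 (i : Fin n) : 0 ≤ d i := by
    have h := (hP.conjTranspose_mul_mul_same Q).diag_nonneg (i := i)
    rwa [conjTranspose_eq_transpose_of_trivial, hd, diagonal_apply_eq] at h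
  obtain ⟨s, σ, hs, hσ⟩ := Fin.exists_perm_lt_iff fun i => 0 < d i
  let c : Fin n → ℝ := fun i => if 0 < d i then (√(d i))⁻¹ else 1
  have hc (i : Fin n) : c i ≠ 0 := by
    by_cases h : 0 < d i
    · simpa [c, h] using (Real.sqrt_pos.2 h).ne'
    · simp [c, h]
  have hcd (i : Fin n) : c i * d i * c i = if 0 < d i then 1 else 0 := by
    by_cases h : 0 < d i
    · have h2 : √(d i) ≠ 0 := (Real.sqrt_pos.2 h).ne'
      simp only [c, h, if_true]
      field_simp
      exact (Real.sq_sqrt h.le).symm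
    · simp [c, le_antisymm (not_lt.1 h) (hd0 i)]
  refine ⟨(Q * diagonal c).submatrix id σ, s, ?_, hs, ?_⟩
  · have hQu : IsUnit Q := IsUnit.of_mul_eq_one_right _ hQ
    have hcu : IsUnit (diagonal c) := by
      rw [isUnit_diagonal, Pi.isUnit_iff]
      exact fun i => (hc i).isUnit
    exact (isUnit_submatrix_equiv (Equiv.refl _) σ).2 (hQu.mul hcu)
  · have h : (Q * diagonal c)ᵀ * P * (Q * diagonal c) =
        diagonal fun i => if 0 < d i then 1 else 0 := by
      rw [transpose_mul, diagonal_transpose,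
        show diagonal c * Qᵀ * P * (Q * diagonal c) = diagonal c * (Qᵀ * P * Q) * diagonal c by
          simp only [Matrix.mul_assoc],
        hd, diagonal_mul_diagonal, diagonal_mul_diagonal]
      simp only [hcd]
    calc ((Q * diagonal c).submatrix id σ)ᵀ * P * (Q * diagonal c).submatrix id σ
        = ((Q * diagonal c)ᵀ * P * (Q * diagonal c)).submatrix σ σ := by
          ext i j
          simp [Matrix.mul_apply]
      _ = _ := by
          rw [h, submatrix_diagonal_equiv]
          congr 1
          ext i
          simp [hσ]

/-- Normal form of a symmetric block matrix with positive semidefinite lower right block under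
congruences preserving the quadratic form `I ⊕ 0`. -/
theorem Matrix.exists_congruence_fromBlocks {m : Type*} [Fintype m] [DecidableEq m] {n : ℕ}
    {A : Matrix m m ℝ} (hA : A.IsSymm) (B : Matrix m (Fin n) ℝ)
    {P : Matrix (Fin n) (Fin n) ℝ} (hP : P.PosSemidef) :
    ∃ (T : Matrix (m ⊕ Fin n) (m ⊕ Fin n) ℝ) (s : ℕ) (d : m → ℝ) (W : Matrix m (Fin n) ℝ),
      IsUnit T ∧ s ≤ n ∧ (∀ i j, j.val < s → W i j = 0) ∧
      Tᵀ * fromBlocks A B Bᵀ P * T =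
        fromBlocks (diagonal d) W Wᵀ (diagonal fun i => if i.val < s then 1 else 0) ∧
      Tᵀ * fromBlocks 1 0 0 0 * T = fromBlocks 1 0 0 0 := by
  obtain ⟨V, s, hV, hs, hD⟩ := hP.exists_congruence_diagonal
  set D : Matrix (Fin n) (Fin n) ℝ := diagonal fun i => if i.val < s then 1 else 0 with hDdef
  have hDt : Dᵀ = D := diagonal_transpose _
  have hDD : D * D = D := by
    rw [hDdef, diagonal_mul_diagonal]
    congr 1
    ext i
    split_ifs <;> simp
  have hPt : Pᵀ = P := by
    have h := hP.isHermitian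
    rwa [Matrix.IsHermitian, conjTranspose_eq_transpose_of_trivial] at h
  set X : Matrix (Fin n) m ℝ := -(V * D * Vᵀ * Bᵀ) with hX
  have hXt : Xᵀ = -(B * V * D * Vᵀ) := by
    simp [hX, transpose_mul, hDt, Matrix.mul_assoc]
  have hS : (A + Xᵀ * Bᵀ + (B + Xᵀ * P) * X).IsSymm := by
    simp only [Matrix.IsSymm, transpose_add, transpose_mul, transpose_transpose, hPt, hA.eq,
      Matrix.add_mul, Matrix.mul_assoc]
    abel
  obtain ⟨U, d, hU, hd⟩ := hS.exists_orthogonal_diagonalization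
  have hW : (B + Xᵀ * P) * V = B * V * (1 - D) := by
    have h : B * V * D * Vᵀ * P * V = B * V * D := by
      rw [show B * V * D * Vᵀ * P * V = B * V * D * (Vᵀ * P * V) by
        simp only [Matrix.mul_assoc], hD, Matrix.mul_assoc (B * V), hDD]
    rw [hXt, Matrix.add_mul, Matrix.neg_mul, Matrix.neg_mul, h, Matrix.mul_sub, Matrix.mul_one,
      sub_eq_add_neg]
  have h12 : Uᵀ * ((B + Xᵀ * P) * V) = Uᵀ * (B * V) * (1 - D) := by
    rw [hW]
    simp only [Matrix.mul_assoc]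
  refine ⟨fromBlocks U 0 (X * U) V, s, d, Uᵀ * (B * V) * (1 - D), ?_, hs, ?_, ?_, ?_⟩
  · rw [isUnit_fromBlocks_zero₁₂]
    exact ⟨IsUnit.of_mul_eq_one_right _ hU, hV⟩
  · intro i j hj
    rw [hDdef, ← diagonal_one, diagonal_sub, mul_diagonal]
    simp [hj]
  · rw [fromBlocks_transpose, fromBlocks_multiply, fromBlocks_multiply, ← hd, ← h12]
    congr 1
    · simp only [transpose_mul, Matrix.mul_add, Matrix.add_mul, Matrix.mul_assoc]
    · simp [transpose_mul, Matrix.mul_add, Matrix.add_mul, Matrix.mul_assoc]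
    · simp [transpose_mul, Matrix.mul_add, Matrix.add_mul, Matrix.mul_assoc, hPt]
    · simpa using hD
  · simp [fromBlocks_transpose, fromBlocks_multiply, hU]

/-- (Congruence normal-form lemma.) Let `G` be a real symmetric
`(r₁+r₂)×(r₁+r₂)` matrix whose lower right `r₂×r₂` block `G₂₂` is positive
semidefinite. Then there are an invertible `T`, an integer `0 ≤ s ≤ r₂`, a
diagonal `r₁×r₁` matrix `Σ` and a matrix `W ∈ ℝ^{r₁×(r₂-s)}` such that `TᵀGT`
is the block matrix `[[Σ, 0, W], [0, I_s, 0], [Wᵀ, 0, 0]]` with block sizes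
`r₁, s, r₂-s`, and moreover `Tᵀ(I_{r₁} ⊕ 0_{r₂})T = I_{r₁} ⊕ 0_{r₂}`. -/
theorem congruence_normal_form (r1 r2 : ℕ)
    (G : Matrix (Fin (r1 + r2)) (Fin (r1 + r2)) ℝ) (hG : G.IsSymm)
    (hG22 : (Matrix.of fun a b : Fin r2 =>
      G ⟨r1 + a.val, Nat.add_lt_add_left a.isLt r1⟩
        ⟨r1 + b.val, Nat.add_lt_add_left b.isLt r1⟩).PosSemidef) :
    ∃ (T : Matrix (Fin (r1 + r2)) (Fin (r1 + r2)) ℝ) (s : ℕ),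
      IsUnit T ∧ s ≤ r2 ∧
      (∃ G' : Matrix (Fin (r1 + r2)) (Fin (r1 + r2)) ℝ, G' = Tᵀ * G * T ∧
        -- (1,1) block is a diagonal matrix Σ
        (∀ a b : Fin (r1 + r2), a.val < r1 → b.val < r1 → a ≠ b → G' a b = 0) ∧
        -- (1,2) block and its transpose are zero
        (∀ a b : Fin (r1 + r2), a.val < r1 → r1 ≤ b.val → b.val < r1 + s → G' a b = 0) ∧
        (∀ a b : Fin (r1 + r2), r1 ≤ a.val → a.val < r1 + s → b.val < r1 → G' a b = 0) ∧
        -- (2,2) block is I_s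
        (∀ a b : Fin (r1 + r2), r1 ≤ a.val → a.val < r1 + s → r1 ≤ b.val → b.val < r1 + s →
          G' a b = if a = b then 1 else 0) ∧
        -- (2,3) block and its transpose are zero
        (∀ a b : Fin (r1 + r2), r1 ≤ a.val → a.val < r1 + s → r1 + s ≤ b.val → G' a b = 0) ∧
        (∀ a b : Fin (r1 + r2), r1 + s ≤ a.val → r1 ≤ b.val → b.val < r1 + s → G' a b = 0) ∧
        -- (3,3) block is zero (the (1,3) block W is arbitrary)
        (∀ a b : Fin (r1 + r2), r1 + s ≤ a.val → r1 + s ≤ b.val → G' a b = 0)) ∧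
      Tᵀ * (Matrix.of fun a b : Fin (r1 + r2) => if a = b ∧ a.val < r1 then (1 : ℝ) else 0) * T =
        Matrix.of fun a b : Fin (r1 + r2) => if a = b ∧ a.val < r1 then (1 : ℝ) else 0 := by
  let e : Fin r1 ⊕ Fin r2 ≃ Fin (r1 + r2) := finSumFinEquiv
  set H := G.submatrix e e with hH
  have hHs : Hᵀ = H := by rw [hH, transpose_submatrix, hG.eq]
  have hA : H.toBlocks₁₁.IsSymm := by
    ext i j
    exact congr_fun₂ hHs (Sum.inl i) (Sum.inl j)
  have hB : H.toBlocks₁₂ᵀ = H.toBlocks₂₁ := by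
    ext i j
    exact congr_fun₂ hHs (Sum.inr i) (Sum.inl j)
  have hP : H.toBlocks₂₂.PosSemidef := hG22
  obtain ⟨T, s, d, W, hT, hs, hW, hTG, hTI⟩ := exists_congruence_fromBlocks hA H.toBlocks₁₂ hP
  rw [hB, fromBlocks_toBlocks] at hTG
  have hcongr (M : Matrix (Fin (r1 + r2)) (Fin (r1 + r2)) ℝ) :
      (T.submatrix e.symm e.symm)ᵀ * M * T.submatrix e.symm e.symm =
        (Tᵀ * M.submatrix e e * T).submatrix e.symm e.symm := by
    simp only [← submatrix_mul_equiv _ _ _ e.symm, transpose_submatrix, submatrix_submatrix,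
      Equiv.self_comp_symm, submatrix_id_id]
  have hI : (Matrix.of fun a b : Fin (r1 + r2) =>
      if a = b ∧ a.val < r1 then (1 : ℝ) else 0).submatrix e e = fromBlocks 1 0 0 0 := by
    ext (i | i) (j | j) <;> simp [e, Matrix.one_apply, Fin.ext_iff]
    omega
  refine ⟨T.submatrix e.symm e.symm, s, (isUnit_submatrix_equiv e.symm e.symm).2 hT, hs,
    ⟨_, rfl, ?_⟩, ?_⟩
  · rw [hcongr, hTG]
    refine ⟨?_, ?_, ?_, ?_, ?_, ?_, ?_⟩ <;>
    · intro a b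
      obtain ⟨a, rfl⟩ := e.surjective a
      obtain ⟨b, rfl⟩ := e.surjective b
      rcases a with a | a <;> rcases b with b | b <;>
        simp [e, diagonal_apply, Fin.ext_iff] <;> grind
  · rw [hcongr, hI, hTI, ← hI, submatrix_submatrix, Equiv.self_comp_symm, submatrix_id_id]
end
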